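/- There exists a family of five line segments in the plane ℝ² that is shattered by halfplanes. (This shows the bound 5 on the VC-dimension of halfplanes with respect to line segments in the plane is tight.) -/

import Mathlib

open RealInnerProductSpace

/-- The Euclidean plane `ℝ²`. -/
abbrev Plane : Type := EuclideanSpace ℝ (Fin 2)

/-- A (closed) halfplane: `{x | ⟪a, x⟫ ≤ b}` for some nonzero `a` and real `b`. -/
def IsHalfplane (h : Set Plane) : Prop :=
  ∃ a : Plane, a ≠ 0 ∧ ∃ b : ℝ, h = {x : Plane | ⟪a, x⟫ ≤ b}

/-- A family of sets in the plane is shattered by halfplanes if every subfamily is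
realized by some halfplane. -/
def ShatteredByHalfplanes {ι : Type} (C : ι → Set Plane) : Prop :=
  ∀ T : Set ι, ∃ h : Set Plane, IsHalfplane h ∧ ∀ i : ι, C i ⊆ h ↔ i ∈ T

/-- The point of the plane with given integer coordinates. -/
noncomputable def latticePoint (p : ℤ × ℤ) : Plane := !₂[(p.1 : ℝ), (p.2 : ℝ)]

theorem inner_latticePoint_le_iff (a p : ℤ × ℤ) (b : ℤ) :
    ⟪latticePoint a, latticePoint p⟫ ≤ (b : ℝ) ↔ a.1 * p.1 + a.2 * p.2 ≤ b := by
  have h : ⟪latticePoint a, latticePoint p⟫ = ((a.1 * p.1 + a.2 * p.2 : ℤ) : ℝ) := by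
    simp [latticePoint, PiLp.inner_apply, Fin.sum_univ_two, mul_comm]
  rw [h, Int.cast_le]

theorem latticePoint_ne_zero {a : ℤ × ℤ} (ha : a ≠ 0) : latticePoint a ≠ 0 := by
  contrapose! ha
  have h0 := congrArg (fun x : Plane => x 0) ha
  have h1 := congrArg (fun x : Plane => x 1) ha
  exact Prod.ext (by simpa [latticePoint] using h0) (by simpa [latticePoint] using h1)

theorem segment_subset_halfplane_iff (a x y : Plane) (b : ℝ) :
    segment ℝ x y ⊆ {z : Plane | ⟪a, z⟫ ≤ b} ↔ ⟪a, x⟫ ≤ b ∧ ⟪a, y⟫ ≤ b := by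
  refine ⟨fun h => ⟨h (left_mem_segment ℝ x y), h (right_mem_segment ℝ x y)⟩, fun h => ?_⟩
  have hc : Convex ℝ {z : Plane | ⟪a, z⟫ ≤ b} :=
    convex_halfSpace_le (innerₛₗ ℝ a).isLinear b
  exact hc.segment_subset h.1 h.2

/-- Shattering of segments with integer endpoints, by halfplanes with integer coefficients. -/
theorem shatteredByHalfplanes_of_int {ι : Type} [Fintype ι] (e : ι → (ℤ × ℤ) × (ℤ × ℤ))
    (h : ∀ T : Finset ι, ∃ a : ℤ × ℤ, ∃ b : ℤ, a ≠ 0 ∧ ∀ i,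
      (a.1 * (e i).1.1 + a.2 * (e i).1.2 ≤ b ∧ a.1 * (e i).2.1 + a.2 * (e i).2.2 ≤ b) ↔ i ∈ T) :
    ShatteredByHalfplanes fun i => segment ℝ (latticePoint (e i).1) (latticePoint (e i).2) := by
  classical
  intro T
  obtain ⟨a, b, ha, hab⟩ := h T.toFinset
  refine ⟨_, ⟨latticePoint a, latticePoint_ne_zero ha, b, rfl⟩, fun i => ?_⟩
  rw [segment_subset_halfplane_iff, inner_latticePoint_le_iff, inner_latticePoint_le_iff, hab,
    Set.mem_toFinset]

/-- The endpoints of five segments with a nearly five-fold rotational symmetry. -/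
def segmentEndpoints : Fin 5 → (ℤ × ℤ) × (ℤ × ℤ) :=
  ![((0, 4), (-1, -2)), ((-4, 2), (1, -2)), ((-3, -3), (2, 1)), ((2, -3), (0, 2)),
    ((4, 1), (-2, 1))]

/-- Coefficients `(a, b)` of the halfplanes `a.1 * x + a.2 * y ≤ b` that realize the subfamilies
of the segments given by `segmentEndpoints`. -/
def halfplaneCoefficients : List ((ℤ × ℤ) × ℤ) :=
  [((1, 0), -10), ((1, 0), 0), ((1, 1), -1), ((1, 0), 1), ((-1, 1), 0), ((1, -1), 1),
    ((1, 3), 5), ((2, -1), 4), ((-1, 0), 0), ((-1, 0), 1), ((1, 1), 2), ((2, 1), 4),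
    ((-1, 1), 2), ((-2, 1), 4), ((1, 1), 3), ((1, 0), 2), ((0, -1), -1), ((1, -3), 5),
    ((-1, -2), 3), ((0, -1), 2), ((0, 1), 1), ((1, -2), 3), ((1, 5), 9), ((1, -1), 3),
    ((-1, -1), 1), ((-1, 0), 2), ((-1, -1), 2), ((-1, -1), 3), ((-1, 1), 3), ((-1, 0), 3),
    ((0, 1), 2), ((1, 0), 10)]

set_option maxRecDepth 100000 in
theorem exists_mem_halfplaneCoefficients (T : Finset (Fin 5)) :
    ∃ c ∈ halfplaneCoefficients, c.1 ≠ 0 ∧ ∀ i,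
      (c.1.1 * (segmentEndpoints i).1.1 + c.1.2 * (segmentEndpoints i).1.2 ≤ c.2 ∧
        c.1.1 * (segmentEndpoints i).2.1 + c.1.2 * (segmentEndpoints i).2.2 ≤ c.2) ↔ i ∈ T := by
  revert T
  decide

/-- There is a family of five segments in the plane that is shattered by halfplanes. -/
theorem five_segments_shattered :
    ∃ s : Fin 5 → Plane × Plane,
      ShatteredByHalfplanes (fun i => segment ℝ (s i).1 (s i).2) := by
  refine ⟨fun i => (latticePoint (segmentEndpoints i).1, latticePoint (segmentEndpoints i).2),
    shatteredByHalfplanes_of_int segmentEndpoints fun T => ?_⟩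
  obtain ⟨c, -, hc⟩ := exists_mem_halfplaneCoefficients T
  exact ⟨c.1, c.2, hc⟩
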